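/- Let n ≥ 1, let r, s : Fin n → ℝ satisfy 0 < r j < ∞ and 0 < s j < ∞ for all j, and let α > 1. Define coth x = cosh x / sinh x, and let V, W be the real diagonal matrices of size 2n × 2n (indexed by Fin n × Fin 2) with diagonal entries V (j, i) = (1/2) · coth((α − 1) · s j / 2) and W (j, i) = (1/2) · coth(α · r j / 2). Then the series ∑_{k ∈ ℕ^n} ∏_{j} ((1 − exp(−r j)) · exp(−(k j) · r j))^α · ((1 − exp(−s j)) · exp(−(k j) · s j))^(1−α) converges (the family is summable) if and only if V − W is positive definite. -/

import Mathlib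

noncomputable def coth (x : ℝ) : ℝ := Real.cosh x / Real.sinh x

theorem coth_lt_coth_iff {x y : ℝ} (hx : 0 < x) (hy : 0 < y) : coth x < coth y ↔ y < x := by
  rw [coth, coth, div_lt_div_iff₀ (Real.sinh_pos_iff.2 hx) (Real.sinh_pos_iff.2 hy),
    ← sub_pos, mul_comm (Real.cosh y), ← Real.sinh_sub, Real.sinh_pos_iff, sub_pos]

/-- A product of nonnegative sequences in independent variables is summable if every sequence is. -/
theorem summable_prod_pi_of_nonneg {ι κ : Type*} [Fintype ι] {f : ι → κ → ℝ}
    (hf : ∀ j m, 0 ≤ f j m) (h : ∀ j, Summable (f j)) :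
    Summable fun k : ι → κ => ∏ j, f j (k j) := by
  classical
  refine summable_of_sum_le (c := ∏ j, ∑' m, f j m)
    (fun k => Finset.prod_nonneg fun j _ => hf j (k j)) fun u => ?_
  calc ∑ k ∈ u, ∏ j, f j (k j)
      ≤ ∑ k ∈ Fintype.piFinset fun j => u.image fun k => k j, ∏ j, f j (k j) :=
        Finset.sum_le_sum_of_subset_of_nonneg
          (fun k hk => Fintype.mem_piFinset.2 fun j => Finset.mem_image_of_mem _ hk)
          fun k _ _ => Finset.prod_nonneg fun j _ => hf j (k j)
    _ = ∏ j, ∑ m ∈ u.image fun k => k j, f j m := (Finset.prod_univ_sum _ _).symm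
    _ ≤ ∏ j, ∑' m, f j m :=
        Finset.prod_le_prod (fun j _ => Finset.sum_nonneg fun m _ => hf j m)
          fun j _ => (h j).sum_le_tsum _ fun m _ => hf j m

theorem summable_of_summable_prod_pi {ι κ : Type*} [Fintype ι] [Nonempty κ] {f : ι → κ → ℝ}
    (hf : ∀ j m, f j m ≠ 0) (h : Summable fun k : ι → κ => ∏ j, f j (k j)) (j : ι) :
    Summable (f j) := by
  classical
  obtain ⟨m₀⟩ := ‹Nonempty κ›
  have hc : ∏ i ∈ Finset.univ.erase j, f i m₀ ≠ 0 := Finset.prod_ne_zero_iff.2 fun i _ => hf i m₀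
  refine (summable_mul_right_iff hc).1
    ((h.comp_injective (Function.update_injective (fun _ : ι => m₀) j)).congr fun m => ?_)
  rw [Function.comp_apply, ← Finset.mul_prod_erase _ _ (Finset.mem_univ j), Function.update_self]
  congr 1
  refine Finset.prod_congr rfl fun i hi => ?_
  rw [Function.update_of_ne (Finset.ne_of_mem_erase hi)]

theorem summable_prod_pi_iff_of_pos {ι κ : Type*} [Fintype ι] [Nonempty κ] {f : ι → κ → ℝ}
    (hf : ∀ j m, 0 < f j m) :
    (Summable fun k : ι → κ => ∏ j, f j (k j)) ↔ ∀ j, Summable (f j) :=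
  ⟨summable_of_summable_prod_pi fun j m => (hf j m).ne',
    summable_prod_pi_of_nonneg fun j m => (hf j m).le⟩

theorem thermal_eigenvalue_rpow_mul_rpow {a b : ℝ} (ha : 0 < a) (hb : 0 < b) (r s α : ℝ) (m : ℕ) :
    (a * Real.exp (-(m : ℝ) * r)) ^ α * (b * Real.exp (-(m : ℝ) * s)) ^ (1 - α) =
      a ^ α * b ^ (1 - α) * Real.exp (m * ((α - 1) * s - α * r)) := by
  rw [Real.mul_rpow ha.le (Real.exp_pos _).le, Real.mul_rpow hb.le (Real.exp_pos _).le,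
    ← Real.exp_mul, ← Real.exp_mul, mul_mul_mul_comm, ← Real.exp_add]
  ring_nf

theorem summable_iff_covariance_posdef
    (n : ℕ) (hn : 1 ≤ n) (r s : Fin n → ℝ)
    (hr : ∀ j, 0 < r j) (hs : ∀ j, 0 < s j)
    (α : ℝ) (hα : 1 < α)
    (V W : Matrix (Fin n × Fin 2) (Fin n × Fin 2) ℝ)
    (hV : V = Matrix.diagonal (fun p => (1 / 2) * coth ((α - 1) * s p.1 / 2)))
    (hW : W = Matrix.diagonal (fun p => (1 / 2) * coth (α * r p.1 / 2))) :
    Summable (fun k : Fin n → ℕ =>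
      ∏ j, ((1 - Real.exp (-(r j))) * Real.exp (-(k j : ℝ) * r j)) ^ α *
        ((1 - Real.exp (-(s j))) * Real.exp (-(k j : ℝ) * s j)) ^ (1 - α)) ↔
    (V - W).PosDef := by
  have one_sub_exp_pos {x : ℝ} (hx : 0 < x) : 0 < 1 - Real.exp (-x) := by simpa using hx
  have coth_lt (j : Fin n) :
      coth (α * r j / 2) < coth ((α - 1) * s j / 2) ↔ (α - 1) * s j - α * r j < 0 := by
    have h₁ : 0 < (α - 1) * s j := mul_pos (sub_pos.2 hα) (hs j)
    have h₂ : 0 < α * r j := mul_pos (one_pos.trans hα) (hr j)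
    rw [coth_lt_coth_iff (half_pos h₂) (half_pos h₁), div_lt_div_iff_of_pos_right two_pos, sub_neg]
  have posDef_iff : (V - W).PosDef ↔ ∀ j, (α - 1) * s j - α * r j < 0 := by
    rw [hV, hW, Matrix.diagonal_sub, Matrix.posDef_diagonal_iff]
    simp [Prod.forall, coth_lt]
  rw [posDef_iff, summable_prod_pi_iff_of_pos (f := fun j (m : ℕ) =>
    ((1 - Real.exp (-(r j))) * Real.exp (-(m : ℝ) * r j)) ^ α *
      ((1 - Real.exp (-(s j))) * Real.exp (-(m : ℝ) * s j)) ^ (1 - α)) fun j m => by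
        have := one_sub_exp_pos (hr j)
        have := one_sub_exp_pos (hs j)
        positivity]
  refine forall_congr' fun j => ?_
  have ha := one_sub_exp_pos (hr j)
  have hb := one_sub_exp_pos (hs j)
  simp_rw [thermal_eigenvalue_rpow_mul_rpow ha hb]
  rw [summable_mul_left_iff (by positivity), Real.summable_exp_nat_mul_iff]
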